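/- Let μ be a measure (finitely supported, nonnegative) on ℤ × ℤ such that the total mass (D₁μ)(Γ) is nonzero. Then the expected value of the function a−b with respect to D₁μ equals −n/2. -/

import Mathlib

open Finsupp Filter

noncomputable section

/-- Signed-sum convention: `signedSum c k = Σ_{i=0}^{k} c i`, which is the ordinary sum for
`k ≥ 0`, is `0` for `k = -1`, and equals `-(c (-1) + c (-2) + ⋯ + c (k+1))` for `k ≤ -2`. -/
def signedSum {M : Type*} [AddCommGroup M] (c : ℤ → M) (k : ℤ) : M :=
  (∑ i ∈ Finset.range (k + 1).toNat, c i) -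
    ∑ i ∈ Finset.range (-(k + 1)).toNat, c (-((i : ℤ) + 1))

/-- The Demazure operator `D₀` (relative to `Λ = mΛ₀ + nΛ₁`):
`D₀ δ_{(a,b)} = Σ_{i=0}^{m - 2(a-b)} δ_{(a+i,b)}`, extended ℤ-linearly. -/
def D0 (m : ℕ) (μ : ℤ × ℤ →₀ ℤ) : ℤ × ℤ →₀ ℤ :=
  μ.sum fun p c =>
    c • signedSum (fun i => Finsupp.single (p.1 + i, p.2) (1 : ℤ)) ((m : ℤ) - 2 * (p.1 - p.2))

/-- The Demazure operator `D₁` (relative to `Λ = mΛ₀ + nΛ₁`):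
`D₁ δ_{(a,b)} = Σ_{i=0}^{n + 2(a-b)} δ_{(a,b+i)}`, extended ℤ-linearly. -/
def D1 (n : ℕ) (μ : ℤ × ℤ →₀ ℤ) : ℤ × ℤ →₀ ℤ :=
  μ.sum fun p c =>
    c • signedSum (fun i => Finsupp.single (p.1, p.2 + i) (1 : ℤ)) ((n : ℤ) + 2 * (p.1 - p.2))

/-- Total mass `μ(Γ)` of a finitely supported function on `ℤ × ℤ`. -/
def mass (μ : ℤ × ℤ →₀ ℤ) : ℤ := μ.sum fun _ c => c

/-- Expected value `E_ν[f] = (1/ν(Γ)) Σ ν(a,b) f(a,b)`. -/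
def expVal (ν : ℤ × ℤ →₀ ℤ) (f : ℤ × ℤ → ℚ) : ℚ :=
  (mass ν : ℚ)⁻¹ * ν.sum fun p c => (c : ℚ) * f p

/-- Covariance `Cov_ν(f,g) = E_ν[f·g] - E_ν[f]·E_ν[g]`. -/
def cov (ν : ℤ × ℤ →₀ ℤ) (f g : ℤ × ℤ → ℚ) : ℚ :=
  expVal ν (fun p => f p * g p) - expVal ν f * expVal ν g

/-- Variance `Var_ν(f) = Cov_ν(f,f)`. -/
def var (ν : ℤ × ℤ →₀ ℤ) (f : ℤ × ℤ → ℚ) : ℚ := cov ν f f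

/-- The coordinate function `a` (the degree). -/
def fa : ℤ × ℤ → ℚ := fun p => (p.1 : ℚ)

/-- The coordinate function `b`. -/
def fb : ℤ × ℤ → ℚ := fun p => (p.2 : ℚ)

/-- The finite-weight coordinate `a - b`. -/
def fab : ℤ × ℤ → ℚ := fun p => (p.1 : ℚ) - (p.2 : ℚ)

/-- `μ_{N,0}`: start from `δ_{(0,0)}`, apply `D₀` at odd steps and `D₁` at even steps. -/
def mu0 (m n : ℕ) : ℕ → (ℤ × ℤ →₀ ℤ)
  | 0 => Finsupp.single (0, 0) 1
  | N + 1 => if N % 2 = 0 then D0 m (mu0 m n N) else D1 n (mu0 m n N)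

/-- `μ_{N,1}`: start from `δ_{(0,0)}`, apply `D₁` at odd steps and `D₀` at even steps. -/
def mu1 (m n : ℕ) : ℕ → (ℤ × ℤ →₀ ℤ)
  | 0 => Finsupp.single (0, 0) 1
  | N + 1 => if N % 2 = 0 then D1 n (mu1 m n N) else D0 m (mu1 m n N)

theorem map_signedSum {M N : Type*} [AddCommGroup M] [AddCommGroup N] (T : M →+ N)
    (c : ℤ → M) (k : ℤ) : T (signedSum c k) = signedSum (fun i => T (c i)) k := by
  simp [signedSum, map_sub, map_sum]

theorem sum_range_two_mul_add (x y : ℚ) (N : ℕ) :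
    2 * ∑ i ∈ Finset.range N, (x + y * i) = N * (2 * x + y * (N - 1)) := by
  induction N with
  | zero => simp
  | succ N ih =>
    rw [Finset.sum_range_succ, mul_add, ih]
    push_cast
    ring

/-- An arithmetic progression with step `-1` starting at `k / 2` is antisymmetric on `0, …, k`. -/
theorem signedSum_half_sub (k : ℤ) : signedSum (fun i => (k : ℚ) / 2 - i) k = 0 := by
  have hfst : ∑ i ∈ Finset.range (k + 1).toNat, ((k : ℚ) / 2 - ((i : ℤ) : ℚ)) = 0 := by
    have hsum := sum_range_two_mul_add ((k : ℚ) / 2) (-1) (k + 1).toNat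
    have hprod : ((k + 1).toNat : ℚ) * (2 * ((k : ℚ) / 2) + -1 * ((k + 1).toNat - 1)) = 0 := by
      rcases le_total 0 (k + 1) with hk | hk
      · have hcast : ((k + 1).toNat : ℚ) = k + 1 := by exact_mod_cast Int.toNat_of_nonneg hk
        rw [hcast]
        ring
      · simp [Int.toNat_of_nonpos hk]
    rw [hprod] at hsum
    simpa [sub_eq_add_neg] using hsum
  have hsnd : ∑ i ∈ Finset.range (-(k + 1)).toNat,
      ((k : ℚ) / 2 - ((-((i : ℤ) + 1) : ℤ) : ℚ)) = 0 := by
    have hsum := sum_range_two_mul_add ((k : ℚ) / 2 + 1) 1 (-(k + 1)).toNat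
    have hprod : ((-(k + 1)).toNat : ℚ) *
        (2 * ((k : ℚ) / 2 + 1) + 1 * ((-(k + 1)).toNat - 1)) = 0 := by
      rcases le_total 0 (-(k + 1)) with hk | hk
      · have hcast : ((-(k + 1)).toNat : ℚ) = -(k + 1) := by
          exact_mod_cast Int.toNat_of_nonneg hk
        rw [hcast]
        ring
      · rw [Int.toNat_of_nonpos hk, Nat.cast_zero, zero_mul]
    rw [hprod, mul_eq_zero] at hsum
    rw [← hsum.resolve_left two_ne_zero]
    refine Finset.sum_congr rfl fun i _ => ?_
    push_cast
    ring
  rw [signedSum, hfst, hsnd, sub_zero]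

/-- The additive functional `ν ↦ Σ ν(p) f(p)`. -/
def integral (f : ℤ × ℤ → ℚ) : (ℤ × ℤ →₀ ℤ) →+ ℚ :=
  Finsupp.liftAddHom fun p => (AddMonoidHom.mulRight (f p)).comp (Int.castAddHom ℚ)

theorem integral_apply (f : ℤ × ℤ → ℚ) (ν : ℤ × ℤ →₀ ℤ) :
    integral f ν = ν.sum fun p c => (c : ℚ) * f p := rfl

theorem integral_single_one (f : ℤ × ℤ → ℚ) (p : ℤ × ℤ) :
    integral f (Finsupp.single p 1) = f p := by
  simp [integral_apply]

theorem integral_add_const (f : ℤ × ℤ → ℚ) (r : ℚ) (ν : ℤ × ℤ →₀ ℤ) :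
    integral (fun p => f p + r) ν = integral f ν + mass ν * r := by
  simp only [integral_apply, mass, Finsupp.sum, mul_add, Finset.sum_add_distrib, Int.cast_sum,
    Finset.sum_mul]

theorem integral_D1_fab_add (n : ℕ) (μ : ℤ × ℤ →₀ ℤ) :
    integral (fun p => fab p + (n : ℚ) / 2) (D1 n μ) = 0 := by
  rw [D1, Finsupp.sum, map_sum]
  refine Finset.sum_eq_zero fun p _ => ?_
  rw [map_zsmul, map_signedSum]
  simp only [integral_single_one]
  convert smul_zero (μ p)
  rw [← signedSum_half_sub ((n : ℤ) + 2 * (p.1 - p.2))]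
  congr 1
  funext i
  simp only [fab]
  push_cast
  ring

/-- For a nonnegative finitely supported measure `μ` on `ℤ × ℤ` with
`(D₁μ)(Γ) ≠ 0`, the expected value of `a - b` with respect to `D₁μ` equals `-n/2`. -/
theorem stmt_1 (n : ℕ) (μ : ℤ × ℤ →₀ ℤ) (hpos : ∀ p, 0 ≤ μ p)
    (h : mass (D1 n μ) ≠ 0) :
    expVal (D1 n μ) fab = -(n : ℚ) / 2 := by
  have hmass : (mass (D1 n μ) : ℚ) ≠ 0 := by exact_mod_cast h
  have hzero := integral_D1_fab_add n μ
  rw [integral_add_const] at hzero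
  rw [expVal, ← integral_apply, inv_mul_eq_iff_eq_mul₀ hmass]
  linarith
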